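/- Let (G, c) be a finite connected electric network, let k ≥ 3, K > 1, and let 1, ..., k be distinct vertices of G. Then there exist constants f = f(k, K) and g = g(k, K) such that for any γ > 0, any s_1, ..., s_k ∈ [γ, Kγ] and any 0 < ε ≤ 1/(fγ): if |R_eff(i ↔ j) − 1/s_i − 1/s_j| ≤ ε for all distinct i, j ∈ {1, ..., k}, then |R_eff(k ↔ {1, ..., k−1}) − 1/s_k − 1/(s_1 + ... + s_{k−1})| ≤ g·ε. -/

import Mathlib

open MeasureTheory Filter Finset

noncomputable section

set_option linter.unusedSectionVars false

namespace WSTPaper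

variable {V : Type} [Fintype V] [DecidableEq V]

/-- The conductance `C_v = Σ_{u ~ v} c(u,v)` of a vertex in the electric network `(G, c)`. -/
def vertCond (G : SimpleGraph V) [DecidableRel G.Adj] (c : Sym2 V → ℝ) (v : V) : ℝ :=
  ∑ u ∈ G.neighborFinset v, c s(u, v)

/-- The Dirichlet energy of a function `h` on the electric network `(G, c)`. -/
def energy (G : SimpleGraph V) [DecidableRel G.Adj] (c : Sym2 V → ℝ) (h : V → ℝ) : ℝ :=
  (1 / 2) * ∑ v : V, ∑ u ∈ G.neighborFinset v, c s(u, v) * (h u - h v) ^ 2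

/-- The effective conductance `C_eff(a ↔ Z)`.  By Dirichlet's principle it equals
`C_a · P_a(τ_Z < τ_a⁺)`, the random-walk characterization of effective conductance. -/
def effCond (G : SimpleGraph V) [DecidableRel G.Adj] (c : Sym2 V → ℝ) (a : V) (Z : Set V) : ℝ :=
  ⨅ h : {h : V → ℝ // h a = 1 ∧ ∀ z ∈ Z, h z = 0}, energy G c (h : V → ℝ)

/-- The effective resistance `R_eff(a ↔ Z) = 1 / (C_a · P_a(τ_Z < τ_a⁺))`. -/
def effResSet (G : SimpleGraph V) [DecidableRel G.Adj] (c : Sym2 V → ℝ) (a : V) (Z : Set V) :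
    ℝ := (effCond G c a Z)⁻¹

/-- The effective resistance `R_eff(a ↔ b) = 1 / (C_a · P_a(τ_b < τ_a⁺))` between two
vertices of the electric network `(G, c)`. -/
def effRes (G : SimpleGraph V) [DecidableRel G.Adj] (c : Sym2 V → ℝ) (a b : V) : ℝ :=
  effResSet G c a {b}

/-- The Dirichlet form, i.e. the symmetric bilinear form polarizing `energy`. -/
def dirichletForm (G : SimpleGraph V) [DecidableRel G.Adj] (c : Sym2 V → ℝ) :
    (V → ℝ) →ₗ[ℝ] (V → ℝ) →ₗ[ℝ] ℝ :=
  LinearMap.mk₂ ℝ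
    (fun f h => (1 / 2) * ∑ v : V, ∑ u ∈ G.neighborFinset v,
      c s(u, v) * ((f u - f v) * (h u - h v)))
    (fun f f' h => by
      simp only [Pi.add_apply, mul_sum, ← sum_add_distrib]
      exact sum_congr rfl fun v _ => sum_congr rfl fun u _ => by ring)
    (fun r f h => by
      simp only [Pi.smul_apply, smul_eq_mul, mul_sum]
      exact sum_congr rfl fun v _ => sum_congr rfl fun u _ => by ring)
    (fun f h h' => by
      simp only [Pi.add_apply, mul_sum, ← sum_add_distrib]
      exact sum_congr rfl fun v _ => sum_congr rfl fun u _ => by ring)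
    (fun r f h => by
      simp only [Pi.smul_apply, smul_eq_mul, mul_sum]
      exact sum_congr rfl fun v _ => sum_congr rfl fun u _ => by ring)

section Network

variable {G : SimpleGraph V} [DecidableRel G.Adj] {c : Sym2 V → ℝ}

lemma dirichletForm_apply (f h : V → ℝ) :
    dirichletForm G c f h = (1 / 2) * ∑ v : V, ∑ u ∈ G.neighborFinset v,
      c s(u, v) * ((f u - f v) * (h u - h v)) := rfl

lemma dirichletForm_self (h : V → ℝ) : dirichletForm G c h h = energy G c h := by
  simp only [dirichletForm_apply, energy, sq]

lemma dirichletForm_comm (f h : V → ℝ) : dirichletForm G c f h = dirichletForm G c h f := by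
  simp only [dirichletForm_apply, mul_comm (f _ - f _)]

lemma cond_nonneg (hc : ∀ e ∈ G.edgeSet, 0 < c e) {u v : V} (h : u ∈ G.neighborFinset v) :
    0 ≤ c s(u, v) :=
  (hc _ (by simpa [SimpleGraph.adj_comm] using h)).le

lemma energy_mono (hc : ∀ e ∈ G.edgeSet, 0 < c e) {f h : V → ℝ}
    (hfh : ∀ u v, (f u - f v) ^ 2 ≤ (h u - h v) ^ 2) : energy G c f ≤ energy G c h := by
  unfold energy
  refine mul_le_mul_of_nonneg_left ?_ (by norm_num)
  exact sum_le_sum fun v _ => sum_le_sum fun u hu =>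
    mul_le_mul_of_nonneg_left (hfh u v) (cond_nonneg hc hu)

lemma energy_nonneg (hc : ∀ e ∈ G.edgeSet, 0 < c e) (h : V → ℝ) : 0 ≤ energy G c h :=
  mul_nonneg (by norm_num) <| sum_nonneg fun _ _ => sum_nonneg fun _ hu =>
    mul_nonneg (cond_nonneg hc hu) (sq_nonneg _)

lemma energy_smul (r : ℝ) (h : V → ℝ) : energy G c (r • h) = r ^ 2 * energy G c h := by
  simp only [← dirichletForm_self, map_smul, LinearMap.smul_apply, smul_eq_mul]
  ring

lemma energy_add_smul (r : ℝ) (f h : V → ℝ) :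
    energy G c (f + r • h)
      = energy G c f + 2 * r * dirichletForm G c f h + r ^ 2 * energy G c h := by
  simp only [← dirichletForm_self, map_add, map_smul, LinearMap.add_apply, LinearMap.smul_apply,
    smul_eq_mul, dirichletForm_comm h f]
  ring

lemma dirichletForm_sq_le (hc : ∀ e ∈ G.edgeSet, 0 < c e) (f h : V → ℝ) :
    dirichletForm G c f h ^ 2 ≤ energy G c f * energy G c h := by
  have key : ∀ r : ℝ, 0 ≤ energy G c h * (r * r) + 2 * dirichletForm G c f h * r
      + energy G c f := fun r => by
    have := energy_nonneg hc (f + r • h)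
    rw [energy_add_smul] at this
    linarith
  have := discrim_le_zero key
  rw [discrim] at this
  linarith

lemma eq_of_energy_eq_zero (hG : G.Connected) (hc : ∀ e ∈ G.edgeSet, 0 < c e) {h : V → ℝ}
    (h0 : energy G c h = 0) (u v : V) : h u = h v := by
  have hadj : ∀ u v, G.Adj u v → h u = h v := by
    intro u v huv
    have hnn : ∀ v, ∀ u ∈ G.neighborFinset v, 0 ≤ c s(u, v) * (h u - h v) ^ 2 :=
      fun v u hu => mul_nonneg (cond_nonneg hc hu) (sq_nonneg _)
    have h1 : ∑ v : V, ∑ u ∈ G.neighborFinset v, c s(u, v) * (h u - h v) ^ 2 = 0 := by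
      unfold energy at h0
      linarith
    rw [sum_eq_zero_iff_of_nonneg fun v _ => sum_nonneg (hnn v)] at h1
    have h2 := h1 v (mem_univ v)
    rw [sum_eq_zero_iff_of_nonneg (hnn v)] at h2
    have h3 := h2 u (by simpa using huv.symm)
    rcases mul_eq_zero.1 h3 with h4 | h4
    · exact absurd h4 (hc _ (by simpa using huv)).ne'
    · exact sub_eq_zero.1 (pow_eq_zero_iff two_ne_zero |>.1 h4)
  obtain ⟨w⟩ := hG.preconnected u v
  induction w with
  | nil => rfl
  | cons huv _ ih => exact (hadj _ _ huv).trans ih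

/-- Existence of the voltage `φ` for the unit current flow between `v` and `a`. -/
lemma exists_voltage (hG : G.Connected) (hc : ∀ e ∈ G.edgeSet, 0 < c e) (a v : V) :
    ∃ φ : V → ℝ, ∀ h, dirichletForm G c φ h = h v - h a := by
  let T : (V → ℝ) →ₗ[ℝ] Module.Dual ℝ (V → ℝ) := dirichletForm G c +
    (LinearMap.proj a : (V → ℝ) →ₗ[ℝ] ℝ).smulRight (LinearMap.proj a : (V → ℝ) →ₗ[ℝ] ℝ)
  have hT : ∀ f h, T f h = dirichletForm G c f h + f a * h a := fun f h => by simp [T]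
  have hinj : Function.Injective T := by
    rw [← LinearMap.ker_eq_bot, LinearMap.ker_eq_bot']
    intro f hf
    have h1 := hT f f
    rw [hf, dirichletForm_self, LinearMap.zero_apply] at h1
    have h2 := energy_nonneg hc f
    have h3 := mul_self_nonneg (f a)
    have h4 : f a = 0 := mul_self_eq_zero.1 (by linarith)
    funext u
    exact (eq_of_energy_eq_zero hG hc (by linarith) u a).trans h4
  have hsurj : Function.Surjective T :=
    (LinearMap.injective_iff_surjective_of_finrank_eq_finrank
      (Subspace.dual_finrank_eq).symm).1 hinj
  obtain ⟨φ, hφ⟩ := hsurj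
    ((LinearMap.proj v : (V → ℝ) →ₗ[ℝ] ℝ) - (LinearMap.proj a : (V → ℝ) →ₗ[ℝ] ℝ))
  have hφ' : ∀ h, dirichletForm G c φ h + φ a * h a = h v - h a := fun h => by
    rw [← hT, hφ]; rfl
  have ha : φ a = 0 := by
    have := hφ' (fun _ => 1)
    simpa [dirichletForm_apply] using this
  exact ⟨φ, fun h => by simpa [ha] using hφ' h⟩

lemma bddBelow_energy (hc : ∀ e ∈ G.edgeSet, 0 < c e) (a : V) (Z : Set V) :
    BddBelow (Set.range fun h : {h : V → ℝ // h a = 1 ∧ ∀ z ∈ Z, h z = 0} =>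
      energy G c (h : V → ℝ)) :=
  ⟨0, by rintro _ ⟨h, rfl⟩; exact energy_nonneg hc _⟩

/-- Thomson's principle, one direction: a unit flow bounds the effective conductance below. -/
lemma inv_energy_le_effCond (hc : ∀ e ∈ G.edgeSet, 0 < c e) {a : V} {Z : Set V} (ha : a ∉ Z)
    {φ : V → ℝ}
    (hφ : ∀ h : V → ℝ, h a = 1 → (∀ z ∈ Z, h z = 0) → dirichletForm G c φ h = 1) :
    0 < energy G c φ ∧ (energy G c φ)⁻¹ ≤ effCond G c a Z := by
  have key : ∀ h : V → ℝ, h a = 1 → (∀ z ∈ Z, h z = 0) →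
      1 ≤ energy G c φ * energy G c h := fun h h1 h2 => by
    have := dirichletForm_sq_le hc φ h
    rwa [hφ h h1 h2, one_pow] at this
  have h1 : (Pi.single a 1 : V → ℝ) a = 1 := by simp
  have h2 : ∀ z ∈ Z, (Pi.single a 1 : V → ℝ) z = 0 := fun z hz => by
    rw [Pi.single_apply, if_neg (by rintro rfl; exact ha hz)]
  have hpos : 0 < energy G c φ := by
    refine (energy_nonneg hc φ).lt_of_ne fun h0 => ?_
    have := key _ h1 h2
    rw [← h0] at this
    linarith
  have : Nonempty {h : V → ℝ // h a = 1 ∧ ∀ z ∈ Z, h z = 0} := ⟨⟨_, h1, h2⟩⟩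
  refine ⟨hpos, le_ciInf fun h => ?_⟩
  rw [inv_le_iff_one_le_mul₀' hpos]
  exact key _ h.2.1 h.2.2

lemma effResSet_le_energy (hc : ∀ e ∈ G.edgeSet, 0 < c e) {a : V} {Z : Set V} (ha : a ∉ Z)
    {φ : V → ℝ}
    (hφ : ∀ h : V → ℝ, h a = 1 → (∀ z ∈ Z, h z = 0) → dirichletForm G c φ h = 1) :
    effResSet G c a Z ≤ energy G c φ := by
  obtain ⟨h1, h2⟩ := inv_energy_le_effCond hc ha hφ
  exact inv_le_of_inv_le₀ h1 h2

/-- A unit flow whose voltage drop to every point of `Z` is at least its energy is optimal. -/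
lemma effResSet_eq_energy (hc : ∀ e ∈ G.edgeSet, 0 < c e) {a : V} {Z : Set V} (ha : a ∉ Z)
    {φ : V → ℝ}
    (hφ : ∀ h : V → ℝ, h a = 1 → (∀ z ∈ Z, h z = 0) → dirichletForm G c φ h = 1)
    (hle : ∀ z ∈ Z, energy G c φ ≤ φ a - φ z) :
    effResSet G c a Z = energy G c φ := by
  obtain ⟨hpos, hC⟩ := inv_energy_le_effCond hc ha hφ
  refine le_antisymm (effResSet_le_energy hc ha hφ) ?_
  set E := energy G c φ with hE
  let ψ : V → ℝ := fun v => max (φ v - φ a + E) 0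
  have hψ : energy G c ψ ≤ E := energy_mono hc fun u v => by
    rw [sq_le_sq]
    refine (abs_max_sub_max_le_abs _ _ _).trans_eq ?_
    congr 1; ring
  have hfeas : (E⁻¹ • ψ) a = 1 ∧ ∀ z ∈ Z, (E⁻¹ • ψ) z = 0 := by
    constructor
    · simp [ψ, hpos.le, hpos.ne']
    · intro z hz
      have := hle z hz
      simp [ψ, max_eq_right (show φ z - φ a + E ≤ 0 by linarith)]
  have hC' : effCond G c a Z ≤ E⁻¹ := by
    refine (ciInf_le (bddBelow_energy hc a Z) ⟨_, hfeas⟩).trans ?_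
    rw [energy_smul]
    calc E⁻¹ ^ 2 * energy G c ψ ≤ E⁻¹ ^ 2 * E := by gcongr
      _ = E⁻¹ := by field_simp
  exact le_inv_of_le_inv₀ ((inv_pos.2 hpos).trans_le hC) hC'

lemma effRes_eq_energy (hc : ∀ e ∈ G.edgeSet, 0 < c e) {a b : V} (hab : a ≠ b)
    {φ : V → ℝ} (hφ : ∀ h : V → ℝ, dirichletForm G c φ h = h a - h b) :
    effRes G c a b = energy G c φ := by
  refine effResSet_eq_energy hc (by simpa using hab) (fun h h1 h2 => ?_) fun z hz => ?_
  · rw [hφ, h1, h2 b rfl, sub_zero]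
  · rw [Set.mem_singleton_iff.1 hz, ← dirichletForm_self, hφ]

variable {ι : Type*} [Fintype ι]

lemma energy_sum_smul (w : ι → V → ℝ) (p : ι → ℝ) :
    energy G c (∑ i, p i • w i)
      = ∑ i, ∑ j, p i * p j * dirichletForm G c (w i) (w j) := by
  simp only [← dirichletForm_self, map_sum, map_smul, LinearMap.sum_apply, LinearMap.smul_apply,
    smul_eq_mul, mul_sum]
  rw [sum_comm]
  congr! 2
  ring

/-- The flow `-∑ i, p i • w i` is a unit flow from `x l` to the other points. -/
lemma dirichletForm_neg_sum_smul {x : ι → V} {l : ι} {w : ι → V → ℝ}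
    (hw : ∀ i h, dirichletForm G c (w i) h = h (x i) - h (x l))
    {p : ι → ℝ} (hp : ∑ i, p i = 1) (hpl : p l = 0) (h : V → ℝ) (h1 : h (x l) = 1)
    (h2 : ∀ z ∈ x '' {i | i ≠ l}, h z = 0) :
    dirichletForm G c (-∑ i, p i • w i) h = 1 := by
  have h3 : ∑ i, p i * h (x i) = 0 := sum_eq_zero fun i _ => by
    by_cases hi : i = l
    · rw [hi, hpl, zero_mul]
    · rw [h2 _ ⟨i, hi, rfl⟩, mul_zero]
  simp only [map_neg, map_sum, map_smul, LinearMap.neg_apply, LinearMap.sum_apply,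
    LinearMap.smul_apply, hw, smul_eq_mul, mul_sub, sum_sub_distrib, ← sum_mul, hp, h1, h3]
  norm_num

lemma energy_neg (h : V → ℝ) : energy G c (-h) = energy G c h := by
  simp only [← dirichletForm_self, map_neg, LinearMap.neg_apply, neg_neg]

lemma notMem_image_ne {x : ι → V} (hx : Function.Injective x) (l : ι) :
    x l ∉ x '' {i | i ≠ l} := by
  rintro ⟨i, hi, hxi⟩
  exact hi (hx hxi)

/-- Among the distributions `p` on the points `x i`, `i ≠ l`, one is the distribution of the exit
point of the unit current flow from `x l`. -/
lemma exists_effResSet_eq_energy [DecidableEq ι] (hc : ∀ e ∈ G.edgeSet, 0 < c e) {x : ι → V}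
    (hx : Function.Injective x) {l l' : ι} (hl' : l' ≠ l) {w : ι → V → ℝ}
    (hw : ∀ i h, dirichletForm G c (w i) h = h (x i) - h (x l)) :
    ∃ p ∈ stdSimplex ℝ ι, p l = 0 ∧
      effResSet G c (x l) (x '' {i | i ≠ l}) = energy G c (∑ i, p i • w i) := by
  have hcomp : IsCompact (stdSimplex ℝ ι ∩ {p | p l = 0}) :=
    (isCompact_stdSimplex ℝ ι).inter_right (isClosed_eq (continuous_apply l) continuous_const)
  have hcont : Continuous fun p : ι → ℝ => energy G c (∑ i, p i • w i) := by
    simp only [energy_sum_smul]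
    fun_prop
  have hmem : ∀ i, i ≠ l → (Pi.single i 1 : ι → ℝ) ∈ stdSimplex ℝ ι ∩ {p | p l = 0} :=
    fun i hi => ⟨single_mem_stdSimplex ℝ i, by simp [hi.symm]⟩
  obtain ⟨p, ⟨hp, hpl⟩, hmin⟩ := hcomp.exists_isMinOn ⟨_, hmem l' hl'⟩ hcont.continuousOn
  refine ⟨p, hp, hpl, ?_⟩
  set φ := ∑ i, p i • w i with hφ
  rw [← energy_neg]
  refine effResSet_eq_energy hc (notMem_image_ne hx l)
    (dirichletForm_neg_sum_smul hw hp.2 hpl) ?_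
  · rintro _ ⟨i, hi, rfl⟩
    rw [energy_neg]
    have hvar : ∀ r ∈ Set.Ioc (0 : ℝ) 1,
        0 ≤ 2 * dirichletForm G c φ (w i - φ) + r * energy G c (w i - φ) := by
      rintro r ⟨hr0, hr1⟩
      have hconv : Convex ℝ (stdSimplex ℝ ι ∩ {p | p l = 0}) :=
        (convex_stdSimplex ℝ ι).inter
          (convex_hyperplane (f := fun p : ι → ℝ => p l) ⟨fun _ _ => rfl, fun _ _ => rfl⟩ 0)
      have h1 := hmin (hconv ⟨hp, hpl⟩ (hmem i hi) (sub_nonneg.2 hr1) hr0.le (by ring))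
      have h2 : ∑ j, ((1 - r) • p + r • (Pi.single i 1 : ι → ℝ)) j • w j
          = φ + r • (w i - φ) := by
        have h3 : ∑ j, (Pi.single i 1 : ι → ℝ) j • w j = w i := by
          simp [Pi.single_apply]
        simp only [Pi.add_apply, Pi.smul_apply, smul_assoc, add_smul,
          sum_add_distrib, ← smul_sum, h3, ← hφ]
        module
      simp only [Set.mem_ofPred_eq, h2, energy_add_smul, ← hφ] at h1
      refine nonneg_of_mul_nonneg_right (a := r) ?_ hr0
      linarith
    have hlim : 0 ≤ 2 * dirichletForm G c φ (w i - φ) := by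
      have ht : Tendsto (fun r : ℝ => 2 * dirichletForm G c φ (w i - φ)
          + r * energy G c (w i - φ)) (nhdsWithin 0 (Set.Ioi 0))
          (nhds (2 * dirichletForm G c φ (w i - φ) + 0 * energy G c (w i - φ))) :=
        tendsto_nhdsWithin_of_tendsto_nhds (Continuous.tendsto (by fun_prop) 0)
      rw [zero_mul, add_zero] at ht
      refine ge_of_tendsto ht ?_
      filter_upwards [Ioc_mem_nhdsGT (zero_lt_one' ℝ)] with r hr using hvar r hr
    rw [map_sub, dirichletForm_self, dirichletForm_comm, hw] at hlim
    simp only [Pi.neg_apply]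
    linarith

lemma effResSet_le_energy_sum (hc : ∀ e ∈ G.edgeSet, 0 < c e) {x : ι → V}
    (hx : Function.Injective x) {l : ι} {w : ι → V → ℝ}
    (hw : ∀ i h, dirichletForm G c (w i) h = h (x i) - h (x l))
    {p : ι → ℝ} (hp : ∑ i, p i = 1) (hpl : p l = 0) :
    effResSet G c (x l) (x '' {i | i ≠ l}) ≤ energy G c (∑ i, p i • w i) := by
  rw [← energy_neg]
  exact effResSet_le_energy hc (notMem_image_ne hx l) (dirichletForm_neg_sum_smul hw hp hpl)

/-- If the resistances are `ε`-close to those of a star with conductances `s i`, then so are the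
energies of the flows from `l`. -/
lemma abs_energy_sum_sub_le [DecidableEq ι] (hc : ∀ e ∈ G.edgeSet, 0 < c e) {x : ι → V}
    (hx : Function.Injective x) {l : ι} {w : ι → V → ℝ}
    (hw : ∀ i h, dirichletForm G c (w i) h = h (x i) - h (x l))
    {t : ι → ℝ} {ε : ℝ} (hε : 0 ≤ ε)
    (hR : ∀ i j, i ≠ j → |effRes G c (x i) (x j) - t i - t j| ≤ ε)
    {p : ι → ℝ} (hp : p ∈ stdSimplex ℝ ι) (hpl : p l = 0) :
    |energy G c (∑ i, p i • w i) - t l - ∑ i, p i ^ 2 * t i| ≤ 3 / 2 * ε := by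
  set A : ι → ι → ℝ := fun i j => dirichletForm G c (w i) (w j) with hA
  have hAl : ∀ i, A i l = 0 := fun i => by
    change dirichletForm G c (w i) (w l) = 0
    rw [dirichletForm_comm, hw, sub_self]
  have hRA : ∀ i j, i ≠ j → effRes G c (x i) (x j) = A i i + A j j - 2 * A i j := by
    intro i j hij
    rw [effRes_eq_energy hc (hx.ne hij) (φ := w i - w j) fun h => by
      rw [map_sub, LinearMap.sub_apply, hw, hw]; ring]
    simp only [hA, ← dirichletForm_self, map_sub, LinearMap.sub_apply,
      dirichletForm_comm (w j) (w i)]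
    ring
  -- deviation of the resistance matrix from that of the star
  set r : ι → ι → ℝ := fun i j =>
    A i i + A j j - 2 * A i j - t i - t j + (if i = j then 2 * t i else 0) with hr
  have hrε : ∀ i j, |r i j| ≤ ε := by
    intro i j
    by_cases hij : i = j
    · subst hij
      have : r i i = 0 := by simp only [hr, if_true]; ring
      rwa [this, abs_zero]
    · have := hR i j hij
      rw [hRA i j hij] at this
      simpa only [hr, if_neg hij, add_zero] using this
  have hdiag : ∀ i, p i * A i i = p i * (t i + t l + r i l) := by
    intro i
    by_cases hi : i = l
    · rw [hi, hpl]; ring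
    · simp only [hr, if_neg hi, hAl]; ring
  have hsum : energy G c (∑ i, p i • w i) - t l - ∑ i, p i ^ 2 * t i
      = ∑ i, p i * r i l - (1 / 2) * ∑ i, ∑ j, p i * p j * r i j := by
    have h1 : ∀ i j, p i * p j * A i j = (1 / 2) * (p j * (p i * A i i))
        + (1 / 2) * (p i * (p j * A j j)) - (1 / 2) * (p j * (p i * t i))
        - (1 / 2) * (p i * (p j * t j)) + p i * (if i = j then p j * t i else 0)
        - (1 / 2) * (p i * p j * r i j) := by
      intro i j
      simp only [hr]
      split_ifs <;> ring
    have h2 : ∑ i, p i * A i i = ∑ i, p i * t i + t l + ∑ i, p i * r i l := by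
      simp only [hdiag, mul_add, sum_add_distrib, ← sum_mul, hp.2, one_mul]
    rw [energy_sum_smul]
    change ∑ i, ∑ j, p i * p j * A i j - _ - _ = _
    simp only [h1, sum_add_distrib, sum_sub_distrib, ← mul_sum, ← sum_mul, hp.2, one_mul,
      sum_ite_eq, mem_univ, if_true, h2]
    have h3 : ∑ i, p i * (p i * t i) = ∑ i, p i ^ 2 * t i := by
      congr! 1; ring
    rw [h3]
    ring
  have hb1 : |∑ i, p i * r i l| ≤ ε := by
    calc |∑ i, p i * r i l| ≤ ∑ i, |p i * r i l| := abs_sum_le_sum_abs _ _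
      _ ≤ ∑ i, p i * ε := by
        gcongr with i
        rw [abs_mul, abs_of_nonneg (hp.1 i)]
        exact mul_le_mul_of_nonneg_left (hrε i l) (hp.1 i)
      _ = ε := by rw [← sum_mul, hp.2, one_mul]
  have hb2 : |∑ i, ∑ j, p i * p j * r i j| ≤ ε := by
    calc |∑ i, ∑ j, p i * p j * r i j| ≤ ∑ i, ∑ j, |p i * p j * r i j| :=
        (abs_sum_le_sum_abs _ _).trans (sum_le_sum fun _ _ => abs_sum_le_sum_abs _ _)
      _ ≤ ∑ i, ∑ j, p i * p j * ε := by
        gcongr with i _ j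
        have hpp := mul_nonneg (hp.1 i) (hp.1 j)
        rw [abs_mul, abs_of_nonneg hpp]
        exact mul_le_mul_of_nonneg_left (hrε i j) hpp
      _ = ε := by simp only [← sum_mul, ← mul_sum, hp.2, mul_one, one_mul]
  rw [hsum]
  rw [abs_le] at hb1 hb2 ⊢
  constructor <;> linarith [hb1.1, hb1.2, hb2.1, hb2.2]

end Network

/-- generalization of Lemma 3.5 of Nachmias–Peres.  For every number of
vertices `m + 1 ≥ 3` and every `K > 1` there exist constants `f = f(k, K)` and `g = g(k, K)`
such that the following holds for every finite connected electric network `(G, c)` and every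
collection `x 0, …, x m` of distinct vertices: for any `γ > 0`, any `s i ∈ [γ, Kγ]` and any
`0 < ε ≤ 1/(f·γ)`, if `|R_eff(x i ↔ x j) − 1/sᵢ − 1/sⱼ| ≤ ε` for all `i ≠ j`, then
`|R_eff(x m ↔ {x 0, …, x (m-1)}) − 1/sₘ − 1/(s₀ + ⋯ + s_{m-1})| ≤ g·ε`. -/
theorem effRes_point_to_set (m : ℕ) (hm : 2 ≤ m) (K : ℝ) (hK : 1 < K) :
    ∃ f g : ℝ, 0 < f ∧ 0 < g ∧
      ∀ (V : Type) (_ : Fintype V) (_ : DecidableEq V)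
        (G : SimpleGraph V) (_ : DecidableRel G.Adj) (c : Sym2 V → ℝ),
        G.Connected → (∀ e ∈ G.edgeSet, 0 < c e) →
        ∀ (x : Fin (m + 1) → V), Function.Injective x →
        ∀ (γ : ℝ), 0 < γ →
        ∀ (s : Fin (m + 1) → ℝ), (∀ i, s i ∈ Set.Icc γ (K * γ)) →
        ∀ (ε : ℝ), 0 < ε → ε ≤ 1 / (f * γ) →
        (∀ i j : Fin (m + 1), i ≠ j →
          |effRes G c (x i) (x j) - (s i)⁻¹ - (s j)⁻¹| ≤ ε) →
        |effResSet G c (x (Fin.last m)) (x '' {i | i ≠ Fin.last m})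
            - (s (Fin.last m))⁻¹
            - (∑ i ∈ Finset.univ.filter (fun i => i ≠ Fin.last m), s i)⁻¹|
          ≤ g * ε := by
  refine ⟨1, 3 / 2, one_pos, by norm_num, ?_⟩
  intro V _ _ G _ c hG hc x hx γ hγ s hs ε hε _ hR
  set l := Fin.last m
  have hspos : ∀ i, 0 < s i := fun i => hγ.trans_le (hs i).1
  choose w hw using fun i => exists_voltage hG hc (x l) (x i)
  have hl' : (0 : Fin (m + 1)) ≠ l := by
    simp [l, Fin.ext_iff]; omega
  set S := ∑ i ∈ univ.filter (fun i => i ≠ l), s i with hS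
  have hSpos : 0 < S := sum_pos (fun i _ => hspos i) ⟨0, by simpa using hl'⟩
  obtain ⟨p, hp, hpl, hpR⟩ := exists_effResSet_eq_energy hc hx hl' hw
  let q : Fin (m + 1) → ℝ := fun i => if i ≠ l then s i / S else 0
  have hql : q l = 0 := by simp [q]
  have hq : q ∈ stdSimplex ℝ (Fin (m + 1)) := by
    constructor
    · intro i
      simp only [q]
      split_ifs
      · exact (div_pos (hspos i) hSpos).le
      · exact le_rfl
    · simp only [q]
      rw [← sum_filter, ← sum_div, ← hS, div_self hSpos.ne']
  have hqS : ∑ i, q i ^ 2 * (s i)⁻¹ = S⁻¹ := by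
    have : ∀ i, q i ^ 2 * (s i)⁻¹ = if i ≠ l then s i / S ^ 2 else 0 := by
      intro i
      have := (hspos i).ne'
      simp only [q]
      split_ifs <;> field_simp
      simp
    simp only [this]
    rw [← sum_filter, ← sum_div, ← hS]
    field_simp
  have hpS : S⁻¹ ≤ ∑ i, p i ^ 2 * (s i)⁻¹ := by
    have hsplit : ∀ F : Fin (m + 1) → ℝ, F l = 0 →
        ∑ i, F i = ∑ i ∈ univ.filter (fun i => i ≠ l), F i := fun F hF => by
      rw [sum_filter]
      refine sum_congr rfl fun i _ => ?_
      split_ifs with h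
      · rfl
      · rw [not_not.1 h, hF]
    have := sq_sum_div_le_sum_sq_div (univ.filter (fun i => i ≠ l)) p (g := s)
      fun i _ => hspos i
    rw [← hsplit p hpl, hp.2, ← hS, one_pow, one_div] at this
    rw [hsplit _ (by simp [hpl])]
    simpa only [div_eq_mul_inv] using this
  have hup := effResSet_le_energy_sum hc hx hw hq.2 hql
  have hq' := abs_energy_sum_sub_le hc hx hw hε.le hR hq hql
  have hp' := abs_energy_sum_sub_le hc hx hw hε.le hR hp hpl
  rw [hqS] at hq'
  rw [← hpR] at hp'
  rw [abs_le] at hq' hp' ⊢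
  constructor <;> linarith [hq'.1, hq'.2, hp'.1, hp'.2]

end WSTPaper
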